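/- The subgroup of GL(3,ℂ) generated by the two matrices I₁I₂ and I₂I₃ is a discrete subgroup (it carries the discrete topology as a subspace of GL(3,ℂ)). This is the even-length subgroup Γ of the (3,3,5;∞)-triangle group, which is a discrete subgroup of the isometry group of the complex hyperbolic plane. -/

import Mathlib

open Matrix

/-- `s₀ = √(4√5 − 5)`. -/
noncomputable def s0 : ℝ := Real.sqrt (4 * Real.sqrt 5 - 5)

/-- `α₀ = −1 + (1+√5)(1 − i·s₀)/4`. -/
noncomputable def alpha0 : ℂ :=
  -1 + (1 + (Real.sqrt 5 : ℂ)) * (1 - Complex.I * (s0 : ℂ)) / 4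

/-- Generating complex reflections of the (3,3,5;∞)-triangle group. -/
noncomputable def I1 : Matrix (Fin 3) (Fin 3) ℂ :=
  !![1, -1, alpha0; 0, -1, 0; 0, 0, -1]

noncomputable def I2 : Matrix (Fin 3) (Fin 3) ℂ :=
  !![-1, 0, 0; -1, 1, -1; 0, 0, -1]

noncomputable def I3 : Matrix (Fin 3) (Fin 3) ℂ :=
  !![-1, 0, 0; 0, -1, 0; (starRingEnd ℂ) alpha0, -1, 1]

/-- Elements of a monoid obtained from the submonoid `⟨a, c⟩` by inserting `n` letters `b`. -/
def syllableLevel {M : Type*} [Monoid M] (a b c : M) : ℕ → Set M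
  | 0 => (Submonoid.closure {a, c} : Submonoid M)
  | n + 1 => {g | ∃ d ∈ Submonoid.closure {a, c}, ∃ h ∈ syllableLevel a b c n, g = d * b * h}

section Combinatorics

variable {M : Type*} [Monoid M] {a b c : M}

theorem mem_dihedral_five_cases (haa : a * a = 1) (hcc : c * c = 1)
    (hac : a * c * a * c * a = c * a * c * a * c) {d : M} (hd : d ∈ Submonoid.closure {a, c}) :
    d ∈ ({1, a, c, a * c, c * a, a * c * a, c * a * c, a * c * a * c, c * a * c * a,
      a * c * a * c * a} : Set M) := by
  have ha' : ∀ x : M, a * (a * x) = x := fun x => by rw [← mul_assoc, haa, one_mul]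
  have hc' : ∀ x : M, c * (c * x) = x := fun x => by rw [← mul_assoc, hcc, one_mul]
  have hca : c * (a * (c * (a * c))) = a * (c * (a * (c * a))) := by
    simpa only [mul_assoc] using hac.symm
  have hca' : c * (a * (c * (a * (c * a)))) = a * (c * (a * c)) := by
    have := congrArg (· * a) hca
    simpa only [mul_assoc, haa, mul_one] using this
  induction hd using Submonoid.closure_induction_left with
  | one => simp
  | mul_left x hx y _ ih =>
    simp only [Set.mem_insert_iff, Set.mem_singleton_iff] at ih hx ⊢
    rcases hx with rfl | rfl <;>
    rcases ih with rfl | rfl | rfl | rfl | rfl | rfl | rfl | rfl | rfl | rfl <;>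
    simp [mul_assoc, haa, hcc, ha', hc', hca, hca']

theorem mul_mem_syllableLevel {n : ℕ} {d g : M} (hd : d ∈ Submonoid.closure {a, c})
    (hg : g ∈ syllableLevel a b c n) : d * g ∈ syllableLevel a b c n := by
  cases n with
  | zero => exact mul_mem hd hg
  | succ n =>
    obtain ⟨e, he, h, hh, rfl⟩ := hg
    exact ⟨d * e, mul_mem hd he, h, hh, by simp only [mul_assoc]⟩

theorem b_mul_mem_syllableLevel {n : ℕ} {g : M} (hg : g ∈ syllableLevel a b c n) :
    b * g ∈ syllableLevel a b c (n + 1) :=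
  ⟨1, one_mem _, g, hg, by simp⟩

theorem syllableLevel_subset_closure (n : ℕ) :
    syllableLevel a b c n ⊆ Submonoid.closure ({a, b, c} : Set M) := by
  have hD : Submonoid.closure {a, c} ≤ Submonoid.closure ({a, b, c} : Set M) :=
    Submonoid.closure_mono (by simp [Set.insert_subset_iff])
  induction n with
  | zero => exact hD
  | succ n ih =>
    rintro _ ⟨d, hd, h, hh, rfl⟩
    exact mul_mem (mul_mem (hD hd) (Submonoid.subset_closure (by simp))) (ih hh)

theorem exists_mem_syllableLevel {g : M} (hg : g ∈ Submonoid.closure ({a, b, c} : Set M)) :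
    ∃ n, g ∈ syllableLevel a b c n := by
  induction hg using Submonoid.closure_induction_left with
  | one => exact ⟨0, one_mem _⟩
  | mul_left x hx y _ ih =>
    obtain ⟨n, hn⟩ := ih
    simp only [Set.mem_insert_iff, Set.mem_singleton_iff] at hx
    rcases hx with rfl | rfl | rfl
    · exact ⟨n, mul_mem_syllableLevel (Submonoid.subset_closure (by simp)) hn⟩
    · exact ⟨n + 1, b_mul_mem_syllableLevel hn⟩
    · exact ⟨n, mul_mem_syllableLevel (Submonoid.subset_closure (by simp)) hn⟩

theorem left_invariant_of_generators {F : M → ℝ} (hFa : ∀ g, F (a * g) = F g)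
    (hFc : ∀ g, F (c * g) = F g) {d : M} (hd : d ∈ Submonoid.closure {a, c}) (g : M) :
    F (d * g) = F g := by
  induction hd using Submonoid.closure_induction_left with
  | one => simp
  | mul_left x hx y _ ih =>
    simp only [Set.mem_insert_iff, Set.mem_singleton_iff] at hx
    rcases hx with rfl | rfl <;> simp [mul_assoc, hFa, hFc, ih]

theorem right_invariant_of_generators {F : M → ℝ} (hFa : ∀ g, F (g * a) = F g)
    (hFc : ∀ g, F (g * c) = F g) {d : M} (hd : d ∈ Submonoid.closure {a, c}) (g : M) :
    F (g * d) = F g := by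
  induction hd using Submonoid.closure_induction_right with
  | one => simp
  | mul_right y _ x hx ih =>
    simp only [Set.mem_insert_iff, Set.mem_singleton_iff] at hx
    rcases hx with rfl | rfl <;> simp [← mul_assoc, hFa, hFc, ih]

/-- A function on the triangle group `(3,3,5)` with the listed convexity properties strictly
increases along shortest paths of vertices stabilised by conjugates of `⟨a, c⟩`. -/
theorem lt_of_shortest {F : M → ℝ}
    (haa : a * a = 1) (hbb : b * b = 1) (hcc : c * c = 1)
    (hab : b * a * b = a * b * a) (hbc : b * c * b = c * b * c)
    (hac : a * c * a * c * a = c * a * c * a * c)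
    (hFa : ∀ g, F (a * g) = F g) (hFc : ∀ g, F (c * g) = F g)
    (hFa' : ∀ g, F (g * a) = F g) (hFc' : ∀ g, F (g * c) = F g) (hF1 : F 1 < F b)
    (hmid : ∀ g ∈ Submonoid.closure ({a, b, c} : Set M),
      (F (b * (a * (c * g))) ≤ F g → F (b * (c * g)) < F (b * g)) ∧
      (F (b * (c * (a * g))) ≤ F g → F (b * (a * g)) < F (b * g)))
    (hfar : ∀ g ∈ Submonoid.closure ({a, b, c} : Set M), F (b * g) ≤ F g →
      ∀ e ∈ ({a * c * a, c * a * c, a * c * a * c, c * a * c * a, a * c * a * c * a} : Set M),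
        F g < F (b * (e * g)))
    (n : ℕ) {g d : M} (hg : g ∈ syllableLevel a b c n) (hd : d ∈ Submonoid.closure {a, c})
    (hmin : ∀ m < n + 1, b * (d * g) ∉ syllableLevel a b c m) : F g < F (b * (d * g)) := by
  have hb' : ∀ x : M, b * (b * x) = x := fun x => by rw [← mul_assoc, hbb, one_mul]
  have hab' : ∀ x : M, b * (a * (b * x)) = a * (b * (a * x)) := fun x => by
    simpa only [mul_assoc] using congrArg (· * x) hab
  have hbc' : ∀ x : M, b * (c * (b * x)) = c * (b * (c * x)) := fun x => by
    simpa only [mul_assoc] using congrArg (· * x) hbc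
  have haD : a ∈ Submonoid.closure {a, c} := Submonoid.subset_closure (by simp)
  have hcD : c ∈ Submonoid.closure {a, c} := Submonoid.subset_closure (by simp)
  induction n generalizing g d with
  | zero =>
    have h1 := right_invariant_of_generators hFa' hFc' hg 1
    have h2 := right_invariant_of_generators hFa' hFc' (mul_mem hd hg) b
    rw [one_mul] at h1
    rwa [h1, h2]
  | succ n ih =>
    obtain ⟨d', hd', g, hg, rfl⟩ := hg
    have he : d * d' ∈ Submonoid.closure {a, c} := mul_mem hd hd'
    have hassoc : d * (d' * b * g) = (d * d') * (b * g) := by simp only [mul_assoc]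
    rw [hassoc] at hmin ⊢
    rw [mul_assoc d', left_invariant_of_generators hFa hFc hd']
    generalize d * d' = e at he hmin
    have hstep : ∀ d₁ ∈ Submonoid.closure {a, c}, ∀ w ∈ Submonoid.closure {a, c},
        ∀ w' ∈ Submonoid.closure {a, c}, b * (e * (b * g)) = w * (b * (w' * (b * (d₁ * g)))) →
        F g < F (b * (d₁ * g)) := by
      intro d₁ hd₁ w hw w' hw' heq
      refine ih hg hd₁ fun m hm hmem => hmin (m + 1) (by omega) ?_
      rw [heq]
      exact mul_mem_syllableLevel hw
        (b_mul_mem_syllableLevel (mul_mem_syllableLevel hw' hmem))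
    have hy : b * g ∈ Submonoid.closure ({a, b, c} : Set M) :=
      syllableLevel_subset_closure (n + 1) (b_mul_mem_syllableLevel hg)
    have hprev : F (b * (b * g)) < F (b * g) := by
      have := hstep 1 (one_mem _) 1 (one_mem _) e he (by simp)
      rw [one_mul] at this
      rwa [hb']
    have hdrop : b * (e * (b * g)) ∉ syllableLevel a b c (n + 1) := hmin _ (by omega)
    have hag := mul_mem_syllableLevel haD hg
    have hcg := mul_mem_syllableLevel hcD hg
    obtain ⟨hmid₁, hmid₂⟩ := hmid _ hy
    have hfar' := hfar _ hy hprev.le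
    have hcases := mem_dihedral_five_cases haa hcc hac he
    by_contra! hle
    simp only [Set.mem_insert_iff, Set.mem_singleton_iff] at hcases hfar'
    rcases hcases with rfl | rfl | rfl | rfl | rfl | h | h | h | h | h
    · rw [one_mul, hb'] at hmin
      exact hmin n (by omega) hg
    · rw [hab'] at hdrop
      exact hdrop (mul_mem_syllableLevel haD (b_mul_mem_syllableLevel hag))
    · rw [hbc'] at hdrop
      exact hdrop (mul_mem_syllableLevel hcD (b_mul_mem_syllableLevel hcg))
    · have h := hmid₁ (by simpa only [mul_assoc] using hle)
      rw [hbc', hFc, hb'] at h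
      refine (hstep c hcD a haD (a * c) (mul_mem haD hcD) ?_).not_gt h
      have : b * (c * (b * (c * g))) = c * (b * g) := by
        rw [hbc', ← mul_assoc c c, hcc, one_mul]
      rw [mul_assoc a c (b * (c * g)), ← hab', this, mul_assoc]
    · have h := hmid₂ (by simpa only [mul_assoc] using hle)
      rw [hab', hFa, hb'] at h
      refine (hstep a haD c hcD (c * a) (mul_mem hcD haD) ?_).not_gt h
      have : b * (a * (b * (a * g))) = a * (b * g) := by
        rw [hab', ← mul_assoc a a, haa, one_mul]
      rw [mul_assoc c a (b * (a * g)), ← hbc', this, mul_assoc]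
    all_goals exact (hfar' e (by simp [h])).not_ge hle

theorem mem_dihedral_or_le {F : M → ℝ}
    (haa : a * a = 1) (hbb : b * b = 1) (hcc : c * c = 1)
    (hab : b * a * b = a * b * a) (hbc : b * c * b = c * b * c)
    (hac : a * c * a * c * a = c * a * c * a * c)
    (hFa : ∀ g, F (a * g) = F g) (hFc : ∀ g, F (c * g) = F g)
    (hFa' : ∀ g, F (g * a) = F g) (hFc' : ∀ g, F (g * c) = F g) (hF1 : F 1 < F b)
    (hmid : ∀ g ∈ Submonoid.closure ({a, b, c} : Set M),
      (F (b * (a * (c * g))) ≤ F g → F (b * (c * g)) < F (b * g)) ∧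
      (F (b * (c * (a * g))) ≤ F g → F (b * (a * g)) < F (b * g)))
    (hfar : ∀ g ∈ Submonoid.closure ({a, b, c} : Set M), F (b * g) ≤ F g →
      ∀ e ∈ ({a * c * a, c * a * c, a * c * a * c, c * a * c * a, a * c * a * c * a} : Set M),
        F g < F (b * (e * g)))
    {g : M} (hg : g ∈ Submonoid.closure ({a, b, c} : Set M)) :
    g ∈ Submonoid.closure {a, c} ∨ F b ≤ F g := by
  classical
  have key : ∀ n : ℕ, ∀ g ∈ syllableLevel a b c (n + 1),
      (∀ m < n + 1, g ∉ syllableLevel a b c m) → F b ≤ F g := by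
    intro n
    induction n with
    | zero =>
      rintro _ ⟨d, hd, g, hg, rfl⟩ -
      rw [mul_assoc, left_invariant_of_generators hFa hFc hd,
        right_invariant_of_generators hFa' hFc' hg]
    | succ n ih =>
      rintro _ ⟨d, hd, g, hg, rfl⟩ hmin
      rw [mul_assoc] at hmin ⊢
      rw [left_invariant_of_generators hFa hFc hd]
      have hlt := lt_of_shortest haa hbb hcc hab hbc hac hFa hFc hFa' hFc' hF1 hmid hfar (n + 1)
        hg (one_mem _) fun m hm hmem => hmin m hm
          (mul_mem_syllableLevel hd (by simpa using hmem))
      rw [one_mul] at hlt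
      exact (ih g hg fun m hm hmem => hmin (m + 1) (by omega)
        (mul_mem_syllableLevel hd (b_mul_mem_syllableLevel hmem))).trans hlt.le
  have hex := exists_mem_syllableLevel hg
  have hmin : ∀ m < Nat.find hex, g ∉ syllableLevel a b c m := fun m hm => Nat.find_min hex hm
  have hmem := Nat.find_spec hex
  generalize Nat.find hex = N at hmin hmem
  cases N with
  | zero => exact Or.inl hmem
  | succ n => exact Or.inr (key n g hmem hmin)

end Combinatorics

/-- The Hermitian form preserved by the triangle group with parameter `a`. -/
noncomputable def triangleForm (a x y z : ℂ) : ℝ :=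
  2 * Complex.normSq x + 2 * Complex.normSq y + 2 * Complex.normSq z +
    2 * (a * (starRingEnd ℂ) x * z - (starRingEnd ℂ) x * y - (starRingEnd ℂ) y * z).re

section Certificates

open Complex ComplexConjugate

variable {f : ℝ} {a : ℂ}

theorem ofReal_triangleForm (a x y z : ℂ) :
    (triangleForm a x y z : ℂ) = 2 * (conj x * x) + 2 * (conj y * y) + 2 * (conj z * z) +
      (a * conj x * z - conj x * y - conj y * z + (conj a * x * conj z - x * conj y -
        y * conj z)) := by
  simp only [triangleForm, ofReal_add, ofReal_mul, normSq_eq_conj_mul_self, ofReal_ofNat]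
  have := add_conj (a * conj x * z - conj x * y - conj y * z)
  simp only [map_sub, map_mul, conj_conj] at this
  push_cast at this
  linear_combination -this

theorem triangleForm_swap (a x y z : ℂ) :
    triangleForm (conj a) z y x = triangleForm a x y z := by
  apply ofReal_injective
  simp only [ofReal_triangleForm, conj_conj]
  ring

theorem distance_two_identity (hf : f ^ 2 = f + 1) (h1 : a * conj a = f + 1)
    (h2 : a + conj a = f - 2) (x y z : ℂ) :
    normSq (y - x - z) + normSq ((-2 - a) * x + (-1 + a) * y + (1 - a) * z) - normSq y
      - normSq ((1 - conj a) * x - z) + triangleForm a x y z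
      = 3 / 2 * normSq ((1 - f + a) * x + 2 * y - 2 * z) := by
  apply ofReal_injective
  have hf' : (f : ℂ) ^ 2 = f + 1 := by exact_mod_cast hf
  push_cast [ofReal_triangleForm, normSq_eq_conj_mul_self]
  simp only [map_add, map_sub, map_mul, map_neg, map_one, map_ofNat, conj_conj, conj_ofReal]
  have hb : conj a = f - 2 - a := by linear_combination h2
  rw [hb] at h1 ⊢
  generalize conj x = x', conj y = y', conj z = z'
  grind

theorem distance_three_identity (hf : f ^ 2 = f + 1) (h1 : a * conj a = f + 1)
    (h2 : a + conj a = f - 2) (x y z : ℂ) :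
    normSq (y - x - z) + normSq ((-2 - a) * x + 3 * y + (f + a - f * a) * z) - 2 * normSq y
      + 2 * triangleForm a x y z
      = 3 / 4 * normSq ((-3 - a) * x + 4 * y + (-1 + f + a - f * a) * z)
        + 3 * normSq (x + a * z) := by
  apply ofReal_injective
  have hf' : (f : ℂ) ^ 2 = f + 1 := by exact_mod_cast hf
  push_cast [ofReal_triangleForm, normSq_eq_conj_mul_self]
  simp only [map_add, map_sub, map_mul, map_neg, map_one, map_ofNat, conj_ofReal]
  have hb : conj a = f - 2 - a := by linear_combination h2
  rw [hb] at h1 ⊢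
  generalize conj x = x', conj y = y', conj z = z'
  grind

theorem distance_five_identity (hf : f ^ 2 = f + 1) (h1 : a * conj a = f + 1)
    (h2 : a + conj a = f - 2) (x y z : ℂ) :
    normSq (y - x - z) + normSq ((3 - 2 * f + a - f * a) * x + 3 * f * y + (f * a - a) * z)
      - 2 * normSq y + 2 * triangleForm a x y z
      = 3 / 2 * normSq (2 * x + (a - 1) * y + (f - 1) * a * z)
        + 1 / 2 * normSq ((-3 - f - a - f * a) * y + 3 * z) + 2 * f * normSq y := by
  apply ofReal_injective
  have hf' : (f : ℂ) ^ 2 = f + 1 := by exact_mod_cast hf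
  push_cast [ofReal_triangleForm, normSq_eq_conj_mul_self]
  simp only [map_add, map_sub, map_mul, map_neg, map_one, map_ofNat, conj_ofReal]
  have hb : conj a = f - 2 - a := by linear_combination h2
  rw [hb] at h1 ⊢
  generalize conj x = x', conj y = y', conj z = z'
  grind

theorem distance_four_identity (hf : f ^ 2 = f + 1) (h1 : a * conj a = f + 1)
    (h2 : a + conj a = f - 2) (x y z : ℂ) :
    f * normSq (y - x - z) + normSq ((3 - 2 * f + a - f * a) * x + (-3 - f - a + f * a) * y
        + (f + a - f * a) * z) - (f + 1) * normSq y + (2 - f) * triangleForm a x y z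
      = (4 + f) / 19 * normSq ((5 - f) * x + (-3 - 3 * a) * y + (1 + f + 8 * a - 4 * f * a) * z)
        + 3 / 361 * normSq ((28 + 7 * f + 4 * a + f * a) * y - 19 * z)
        + (7 + 16 * f) / 19 * normSq y := by
  apply ofReal_injective
  have hf' : (f : ℂ) ^ 2 = f + 1 := by exact_mod_cast hf
  push_cast [ofReal_triangleForm, normSq_eq_conj_mul_self]
  simp only [map_add, map_sub, map_mul, map_neg, map_one, map_ofNat, conj_ofReal]
  have hb : conj a = f - 2 - a := by linear_combination h2
  rw [hb] at h1 ⊢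
  generalize conj x = x', conj y = y', conj z = z'
  grind

theorem lt_of_distance_four_identity {q u w t A B C : ℝ} (hpos : 0 < f) (hlt : f < 2) (hq : q < 0)
    (hu : u ≤ t) (hA : 0 ≤ A) (hB : 0 ≤ B) (hC : 0 ≤ C)
    (h : f * u + w - (f + 1) * t + (2 - f) * q
      = (4 + f) / 19 * A + 3 / 361 * B + (7 + 16 * f) / 19 * C) : t < w := by
  have h1 : f * u ≤ f * t := mul_le_mul_of_nonneg_left hu hpos.le
  have h2 : (2 - f) * q < 0 := mul_neg_of_pos_of_neg (by linarith) hq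
  have h3 : 0 ≤ (4 + f) / 19 * A + 3 / 361 * B + (7 + 16 * f) / 19 * C := by positivity
  linarith

end Certificates

section TriangleGroup

open Complex ComplexConjugate

theorem goldenRatio_sq_cast : (Real.goldenRatio : ℂ) ^ 2 = Real.goldenRatio + 1 := by
  exact_mod_cast Real.goldenRatio_sq

theorem alpha0_eq : alpha0 = -1 + Real.goldenRatio * (1 - I * s0) / 2 := by
  rw [alpha0, Real.goldenRatio]
  push_cast
  ring

theorem conj_alpha0_eq : conj alpha0 = -1 + Real.goldenRatio * (1 + I * s0) / 2 := by
  simp only [alpha0_eq, map_add, map_sub, map_neg, map_mul, map_div₀, map_one, map_ofNat, conj_I,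
    conj_ofReal]
  ring

theorem alpha0_add_conj : alpha0 + conj alpha0 = Real.goldenRatio - 2 := by
  rw [conj_alpha0_eq, alpha0_eq]
  ring

theorem s0_sq : s0 ^ 2 = 8 * Real.goldenRatio - 9 := by
  have h : (5 / 4 : ℝ) ≤ Real.sqrt 5 := Real.le_sqrt_of_sq_le (by norm_num)
  rw [s0, Real.sq_sqrt (by linarith), Real.goldenRatio]
  ring

theorem alpha0_mul_conj : alpha0 * conj alpha0 = Real.goldenRatio + 1 := by
  have hs : (s0 : ℂ) ^ 2 = 8 * Real.goldenRatio - 9 := by exact_mod_cast s0_sq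
  have hf := goldenRatio_sq_cast
  rw [conj_alpha0_eq, alpha0_eq]
  have hI := I_sq
  generalize (Real.goldenRatio : ℂ) = f, (s0 : ℂ) = s at *
  grind

theorem conj_alpha0_eq_sub : conj alpha0 = Real.goldenRatio - 2 - alpha0 := by
  linear_combination alpha0_add_conj

theorem alpha0_sq :
    alpha0 ^ 2 = (Real.goldenRatio - 2) * alpha0 - (Real.goldenRatio + 1) := by
  have h := alpha0_mul_conj
  rw [conj_alpha0_eq_sub] at h
  linear_combination -h

theorem I1_mulVec (v : Fin 3 → ℂ) :
    I1.mulVec v = ![v 0 - v 1 + alpha0 * v 2, -v 1, -v 2] := by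
  ext i
  fin_cases i <;> simp [I1, Matrix.mulVec, dotProduct, Fin.sum_univ_three]
  ring

theorem I2_mulVec (v : Fin 3 → ℂ) : I2.mulVec v = ![-v 0, v 1 - v 0 - v 2, -v 2] := by
  ext i
  fin_cases i <;> simp [I2, Matrix.mulVec, dotProduct, Fin.sum_univ_three]
  ring

theorem I3_mulVec (v : Fin 3 → ℂ) :
    I3.mulVec v = ![-v 0, -v 1, conj alpha0 * v 0 - v 1 + v 2] := by
  ext i
  fin_cases i <;> simp [I3, Matrix.mulVec, dotProduct, Fin.sum_univ_three]
  ring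

theorem matrix_ext_mulVec {A B : Matrix (Fin 3) (Fin 3) ℂ} (h : ∀ v, A.mulVec v = B.mulVec v) :
    A = B :=
  Matrix.mulVec_injective (funext h)

theorem I1_mul_self : I1 * I1 = 1 := by
  refine matrix_ext_mulVec fun v => ?_
  ext i
  fin_cases i <;> simp [← Matrix.mulVec_mulVec, I1_mulVec]
  ring

theorem I2_mul_self : I2 * I2 = 1 := by
  refine matrix_ext_mulVec fun v => ?_
  ext i
  fin_cases i <;> simp [← Matrix.mulVec_mulVec, I2_mulVec]
  ring

theorem I3_mul_self : I3 * I3 = 1 := by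
  refine matrix_ext_mulVec fun v => ?_
  ext i
  fin_cases i <;> simp [← Matrix.mulVec_mulVec, I3_mulVec]
  ring

theorem I2_I1_braid : I2 * I1 * I2 = I1 * I2 * I1 := by
  refine matrix_ext_mulVec fun v => ?_
  ext i
  fin_cases i <;> simp [← Matrix.mulVec_mulVec, I1_mulVec, I2_mulVec] <;> ring

theorem I2_I3_braid : I2 * I3 * I2 = I3 * I2 * I3 := by
  refine matrix_ext_mulVec fun v => ?_
  ext i
  fin_cases i <;> simp [← Matrix.mulVec_mulVec, I2_mulVec, I3_mulVec] <;> ring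

theorem I1_I3_braid : I1 * I3 * I1 * I3 * I1 = I3 * I1 * I3 * I1 * I3 := by
  have hf := goldenRatio_sq_cast
  have ha := alpha0_sq
  have hc := conj_alpha0_eq_sub
  generalize (Real.goldenRatio : ℂ) = f at hf ha hc
  refine matrix_ext_mulVec fun v => ?_
  ext i
  fin_cases i <;> simp [← Matrix.mulVec_mulVec, I1_mulVec, I3_mulVec, hc] <;> grind

theorem triangleForm_I1 (v : Fin 3 → ℂ) :
    triangleForm alpha0 (I1.mulVec v 0) (I1.mulVec v 1) (I1.mulVec v 2)
      = triangleForm alpha0 (v 0) (v 1) (v 2) := by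
  apply ofReal_injective
  simp only [I1_mulVec, ofReal_triangleForm, Matrix.cons_val, map_add, map_sub, map_mul, map_neg]
  ring

theorem triangleForm_I2 (v : Fin 3 → ℂ) :
    triangleForm alpha0 (I2.mulVec v 0) (I2.mulVec v 1) (I2.mulVec v 2)
      = triangleForm alpha0 (v 0) (v 1) (v 2) := by
  apply ofReal_injective
  simp only [I2_mulVec, ofReal_triangleForm, Matrix.cons_val, map_sub, map_neg]
  ring

theorem triangleForm_I3 (v : Fin 3 → ℂ) :
    triangleForm alpha0 (I3.mulVec v 0) (I3.mulVec v 1) (I3.mulVec v 2)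
      = triangleForm alpha0 (v 0) (v 1) (v 2) := by
  apply ofReal_injective
  simp only [I3_mulVec, ofReal_triangleForm, Matrix.cons_val, map_add, map_sub, map_mul, map_neg,
    conj_conj]
  ring

/-- The common fixed point in the complex hyperbolic plane of `I1` and `I3`. -/
noncomputable def basePoint : Fin 3 → ℂ :=
  ![2 - alpha0, 3 - Real.goldenRatio, 2 - conj alpha0]

theorem I1_mulVec_basePoint : I1.mulVec basePoint = -basePoint := by
  have h := alpha0_mul_conj
  have h' := alpha0_add_conj
  rw [I1_mulVec, basePoint]
  generalize (Real.goldenRatio : ℂ) = f at h h' ⊢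
  ext i
  fin_cases i <;> simp
  linear_combination -h

theorem I3_mulVec_basePoint : I3.mulVec basePoint = -basePoint := by
  have h := alpha0_mul_conj
  rw [I3_mulVec, basePoint]
  generalize (Real.goldenRatio : ℂ) = f at h ⊢
  ext i
  fin_cases i <;> simp
  linear_combination -h

theorem triangleForm_basePoint :
    triangleForm alpha0 (basePoint 0) (basePoint 1) (basePoint 2) < 0 := by
  have h : triangleForm alpha0 (basePoint 0) (basePoint 1) (basePoint 2)
      = -(Real.goldenRatio * (3 - Real.goldenRatio)) := by
    apply ofReal_injective
    have hf := goldenRatio_sq_cast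
    have ha := alpha0_sq
    rw [ofReal_triangleForm]
    simp only [basePoint, Matrix.cons_val, map_sub, map_ofNat, conj_ofReal, conj_alpha0_eq_sub,
      ofReal_neg, ofReal_mul, ofReal_sub, ofReal_ofNat]
    generalize (Real.goldenRatio : ℂ) = f at hf ha ⊢
    grind
  have := Real.goldenRatio_pos
  have := Real.goldenRatio_lt_two
  rw [h]
  nlinarith

/-- The squared modulus of the Hermitian product of `basePoint` and `g • basePoint`, up to a
constant. -/
noncomputable def height (g : Matrix (Fin 3) (Fin 3) ℂ) : ℝ :=
  normSq (g.mulVec basePoint 1)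

theorem triangleForm_orbit_neg {g : Matrix (Fin 3) (Fin 3) ℂ}
    (hg : g ∈ Submonoid.closure ({I1, I2, I3} : Set (Matrix (Fin 3) (Fin 3) ℂ))) :
    triangleForm alpha0 (g.mulVec basePoint 0) (g.mulVec basePoint 1) (g.mulVec basePoint 2)
      < 0 := by
  induction hg using Submonoid.closure_induction_left with
  | one => simpa using triangleForm_basePoint
  | mul_left x hx y _ ih =>
    simp only [Set.mem_insert_iff, Set.mem_singleton_iff] at hx
    rcases hx with rfl | rfl | rfl <;>
    simpa only [← Matrix.mulVec_mulVec, triangleForm_I1, triangleForm_I2, triangleForm_I3] using ih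

theorem height_one_lt : height 1 < height I2 := by
  have h1 := Real.goldenRatio_pos
  have h2 := Real.goldenRatio_lt_two
  have e1 : height 1 = (3 - Real.goldenRatio) ^ 2 := by
    rw [height, Matrix.one_mulVec, show basePoint 1 = ((3 - Real.goldenRatio : ℝ) : ℂ) by
      simp [basePoint], normSq_ofReal, sq]
  have e2 : height I2 = 9 := by
    have : I2.mulVec basePoint 1 = ((-3 : ℝ) : ℂ) := by
      rw [I2_mulVec]
      simp only [basePoint, Matrix.cons_val, ofReal_neg, ofReal_ofNat]
      linear_combination alpha0_add_conj
    rw [height, this, normSq_ofReal]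
    norm_num
  rw [e1, e2]
  nlinarith

theorem height_mid (v : Fin 3 → ℂ) (hv : triangleForm alpha0 (v 0) (v 1) (v 2) < 0) :
    (normSq (I2.mulVec (I1.mulVec (I3.mulVec v)) 1) ≤ normSq (v 1) →
      normSq (I2.mulVec (I3.mulVec v) 1) < normSq (I2.mulVec v 1)) ∧
    (normSq (I2.mulVec (I3.mulVec (I1.mulVec v)) 1) ≤ normSq (v 1) →
      normSq (I2.mulVec (I1.mulVec v) 1) < normSq (I2.mulVec v 1)) := by
  have hm := alpha0_mul_conj
  have hs := alpha0_add_conj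
  have hm' : conj alpha0 * conj (conj alpha0) = Real.goldenRatio + 1 := by
    rw [conj_conj, mul_comm, hm]
  have hs' : conj alpha0 + conj (conj alpha0) = Real.goldenRatio - 2 := by
    rw [conj_conj, add_comm, hs]
  have hv' := triangleForm_swap alpha0 (v 0) (v 1) (v 2)
  have id₁ := distance_two_identity Real.goldenRatio_sq hm hs (v 0) (v 1) (v 2)
  have id₂ := distance_two_identity Real.goldenRatio_sq hm' hs' (v 2) (v 1) (v 0)
  rw [conj_conj] at id₂
  have nn₁ := normSq_nonneg ((1 - Real.goldenRatio + alpha0) * v 0 + 2 * v 1 - 2 * v 2)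
  have nn₂ := normSq_nonneg ((1 - Real.goldenRatio + conj alpha0) * v 2 + 2 * v 1 - 2 * v 0)
  have r₀ : I2.mulVec v 1 = v 1 - v 0 - v 2 := by simp [I2_mulVec]
  have r₀' : v 1 - v 2 - v 0 = v 1 - v 0 - v 2 := by ring
  have r₁ : I2.mulVec (I1.mulVec (I3.mulVec v)) 1
      = (-2 - alpha0) * v 0 + (-1 + alpha0) * v 1 + (1 - alpha0) * v 2 := by
    simp only [I1_mulVec, I2_mulVec, I3_mulVec, Matrix.cons_val]
    linear_combination -v 0 * hm + v 0 * hs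
  have r₂ : I2.mulVec (I3.mulVec (I1.mulVec v)) 1
      = (-2 - conj alpha0) * v 2 + (-1 + conj alpha0) * v 1 + (1 - conj alpha0) * v 0 := by
    simp only [I1_mulVec, I2_mulVec, I3_mulVec, Matrix.cons_val]
    linear_combination -v 2 * hm + v 2 * hs
  have m₁ : I2.mulVec (I3.mulVec v) 1 = (1 - conj alpha0) * v 0 - v 2 := by
    simp only [I2_mulVec, I3_mulVec, Matrix.cons_val]
    ring
  have m₂ : I2.mulVec (I1.mulVec v) 1 = (1 - alpha0) * v 2 - v 0 := by
    simp only [I2_mulVec, I1_mulVec, Matrix.cons_val]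
    ring
  rw [r₀'] at id₂
  rw [r₀, r₁, r₂, m₁, m₂]
  exact ⟨fun h' => by linarith, fun h' => by linarith⟩

theorem height_far (v : Fin 3 → ℂ) (hv : triangleForm alpha0 (v 0) (v 1) (v 2) < 0)
    (h : normSq (I2.mulVec v 1) ≤ normSq (v 1)) {e : Matrix (Fin 3) (Fin 3) ℂ}
    (he : e ∈ ({I1 * I3 * I1, I3 * I1 * I3, I1 * I3 * I1 * I3, I3 * I1 * I3 * I1,
      I1 * I3 * I1 * I3 * I1} : Set (Matrix (Fin 3) (Fin 3) ℂ))) :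
    normSq (v 1) < normSq (I2.mulVec (e.mulVec v) 1) := by
  have hf := goldenRatio_sq_cast
  have ha := alpha0_sq
  have hc := conj_alpha0_eq_sub
  have hm := alpha0_mul_conj
  have hs := alpha0_add_conj
  have hm' : conj alpha0 * conj (conj alpha0) = Real.goldenRatio + 1 := by
    rw [conj_conj, mul_comm, hm]
  have hs' : conj alpha0 + conj (conj alpha0) = Real.goldenRatio - 2 := by
    rw [conj_conj, add_comm, hs]
  have hpos := Real.goldenRatio_pos
  have hlt := Real.goldenRatio_lt_two
  have hv' := triangleForm_swap alpha0 (v 0) (v 1) (v 2)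
  have r₀ : I2.mulVec v 1 = v 1 - v 0 - v 2 := by simp [I2_mulVec]
  have r₀' : v 1 - v 2 - v 0 = v 1 - v 0 - v 2 := by ring
  have nn := normSq_nonneg
  rw [r₀] at h
  simp only [Set.mem_insert_iff, Set.mem_singleton_iff] at he
  rcases he with rfl | rfl | rfl | rfl | rfl
  · have id := distance_three_identity Real.goldenRatio_sq hm hs (v 0) (v 1) (v 2)
    have r : I2.mulVec ((I1 * I3 * I1).mulVec v) 1 = (-2 - alpha0) * v 0 + 3 * v 1
        + (Real.goldenRatio + alpha0 - Real.goldenRatio * alpha0) * v 2 := by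
      simp only [← Matrix.mulVec_mulVec, I1_mulVec, I2_mulVec, I3_mulVec, Matrix.cons_val,
        hc]
      generalize (Real.goldenRatio : ℂ) = f at hf ha ⊢
      grind
    rw [r]
    linarith [nn ((-3 - alpha0) * v 0 + 4 * v 1
        + (-1 + Real.goldenRatio + alpha0 - Real.goldenRatio * alpha0) * v 2),
      nn (v 0 + alpha0 * v 2)]
  · have id := distance_three_identity Real.goldenRatio_sq hm' hs' (v 2) (v 1) (v 0)
    have r : I2.mulVec ((I3 * I1 * I3).mulVec v) 1 = (-2 - conj alpha0) * v 2 + 3 * v 1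
        + (Real.goldenRatio + conj alpha0 - Real.goldenRatio * conj alpha0) * v 0 := by
      simp only [← Matrix.mulVec_mulVec, I1_mulVec, I2_mulVec, I3_mulVec, Matrix.cons_val,
        hc]
      generalize (Real.goldenRatio : ℂ) = f at hf ha ⊢
      grind
    rw [r]
    rw [r₀'] at id
    linarith [nn ((-3 - conj alpha0) * v 2 + 4 * v 1
        + (-1 + Real.goldenRatio + conj alpha0 - Real.goldenRatio * conj alpha0) * v 0),
      nn (v 2 + conj alpha0 * v 0)]
  · have id := distance_four_identity Real.goldenRatio_sq hm hs (v 0) (v 1) (v 2)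
    have r : I2.mulVec ((I1 * I3 * I1 * I3).mulVec v) 1
        = (3 - 2 * Real.goldenRatio + alpha0 - Real.goldenRatio * alpha0) * v 0
          + (-3 - Real.goldenRatio - alpha0 + Real.goldenRatio * alpha0) * v 1
          + (Real.goldenRatio + alpha0 - Real.goldenRatio * alpha0) * v 2 := by
      simp only [← Matrix.mulVec_mulVec, I1_mulVec, I2_mulVec, I3_mulVec, Matrix.cons_val,
        hc]
      generalize (Real.goldenRatio : ℂ) = f at hf ha ⊢
      grind
    rw [r]
    refine lt_of_distance_four_identity hpos hlt hv h (nn _) (nn _) (nn _) id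
  · have id := distance_four_identity Real.goldenRatio_sq hm' hs' (v 2) (v 1) (v 0)
    have r : I2.mulVec ((I3 * I1 * I3 * I1).mulVec v) 1
        = (3 - 2 * Real.goldenRatio + conj alpha0 - Real.goldenRatio * conj alpha0) * v 2
          + (-3 - Real.goldenRatio - conj alpha0 + Real.goldenRatio * conj alpha0) * v 1
          + (Real.goldenRatio + conj alpha0 - Real.goldenRatio * conj alpha0) * v 0 := by
      simp only [← Matrix.mulVec_mulVec, I1_mulVec, I2_mulVec, I3_mulVec, Matrix.cons_val,
        hc]
      generalize (Real.goldenRatio : ℂ) = f at hf ha ⊢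
      grind
    rw [r]
    rw [r₀'] at id
    refine lt_of_distance_four_identity hpos hlt (hv'.trans_lt hv) h (nn _) (nn _) (nn _) id
  · have id := distance_five_identity Real.goldenRatio_sq hm hs (v 0) (v 1) (v 2)
    have r : I2.mulVec ((I1 * I3 * I1 * I3 * I1).mulVec v) 1
        = (3 - 2 * Real.goldenRatio + alpha0 - Real.goldenRatio * alpha0) * v 0
          + 3 * Real.goldenRatio * v 1 + (Real.goldenRatio * alpha0 - alpha0) * v 2 := by
      simp only [← Matrix.mulVec_mulVec, I1_mulVec, I2_mulVec, I3_mulVec, Matrix.cons_val,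
        hc]
      generalize (Real.goldenRatio : ℂ) = f at hf ha ⊢
      grind
    rw [r]
    have := mul_nonneg hpos.le (nn (v 1))
    linarith [nn (2 * v 0 + (alpha0 - 1) * v 1 + (Real.goldenRatio - 1) * alpha0 * v 2),
      nn ((-3 - Real.goldenRatio - alpha0 - Real.goldenRatio * alpha0) * v 1 + 3 * v 2)]

theorem mem_stabilizer_or_height_le {g : Matrix (Fin 3) (Fin 3) ℂ}
    (hg : g ∈ Submonoid.closure ({I1, I2, I3} : Set (Matrix (Fin 3) (Fin 3) ℂ))) :
    g ∈ Submonoid.closure ({I1, I3} : Set (Matrix (Fin 3) (Fin 3) ℂ)) ∨ height I2 ≤ height g := by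
  refine mem_dihedral_or_le I1_mul_self I2_mul_self I3_mul_self I2_I1_braid I2_I3_braid I1_I3_braid
    ?_ ?_ ?_ ?_ height_one_lt ?_ ?_ hg
  · intro g
    simp [height, ← Matrix.mulVec_mulVec, I1_mulVec]
  · intro g
    simp [height, ← Matrix.mulVec_mulVec, I3_mulVec]
  · intro g
    simp [height, ← Matrix.mulVec_mulVec, I1_mulVec_basePoint, Matrix.mulVec_neg]
  · intro g
    simp [height, ← Matrix.mulVec_mulVec, I3_mulVec_basePoint, Matrix.mulVec_neg]
  · intro g hg
    simp only [height, ← Matrix.mulVec_mulVec]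
    exact height_mid _ (triangleForm_orbit_neg hg)
  · intro g hg h e he
    simp only [height, ← Matrix.mulVec_mulVec] at h ⊢
    exact height_far _ (triangleForm_orbit_neg hg) h he

theorem coe_mem_of_mem_closure {g1 g2 : GL (Fin 3) ℂ}
    (h1 : (g1 : Matrix (Fin 3) (Fin 3) ℂ) = I1 * I2)
    (h2 : (g2 : Matrix (Fin 3) (Fin 3) ℂ) = I2 * I3) {g : GL (Fin 3) ℂ}
    (hg : g ∈ Subgroup.closure ({g1, g2} : Set (GL (Fin 3) ℂ))) :
    (g : Matrix (Fin 3) (Fin 3) ℂ) ∈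
      Submonoid.closure ({I1, I2, I3} : Set (Matrix (Fin 3) (Fin 3) ℂ)) := by
  set S := Submonoid.closure ({I1, I2, I3} : Set (Matrix (Fin 3) (Fin 3) ℂ))
  have m1 : I1 ∈ S := Submonoid.subset_closure (by simp)
  have m2 : I2 ∈ S := Submonoid.subset_closure (by simp)
  have m3 : I3 ∈ S := Submonoid.subset_closure (by simp)
  have i1 : ((g1⁻¹ : GL (Fin 3) ℂ) : Matrix (Fin 3) (Fin 3) ℂ) = I2 * I1 := by
    refine Units.inv_eq_of_mul_eq_one_right ?_
    rw [h1, mul_assoc, ← mul_assoc I2, I2_mul_self, one_mul, I1_mul_self]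
  have i2 : ((g2⁻¹ : GL (Fin 3) ℂ) : Matrix (Fin 3) (Fin 3) ℂ) = I3 * I2 := by
    refine Units.inv_eq_of_mul_eq_one_right ?_
    rw [h2, mul_assoc, ← mul_assoc I3, I3_mul_self, one_mul, I2_mul_self]
  induction hg using Subgroup.closure_induction_left with
  | one => exact one_mem S
  | mul_left x hx y _ ih =>
    simp only [Set.mem_insert_iff, Set.mem_singleton_iff] at hx
    rw [Units.val_mul]
    refine mul_mem ?_ ih
    rcases hx with rfl | rfl
    · exact h1 ▸ mul_mem m1 m2
    · exact h2 ▸ mul_mem m2 m3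
  | inv_mul_cancel x hx y _ ih =>
    simp only [Set.mem_insert_iff, Set.mem_singleton_iff] at hx
    rw [Units.val_mul]
    refine mul_mem ?_ ih
    rcases hx with rfl | rfl
    · exact i1 ▸ mul_mem m2 m1
    · exact i2 ▸ mul_mem m3 m2

theorem finite_stabilizer :
    (Submonoid.closure ({I1, I3} : Set (Matrix (Fin 3) (Fin 3) ℂ)) :
      Set (Matrix (Fin 3) (Fin 3) ℂ)).Finite :=
  Set.Finite.subset (by simp) fun _ hd =>
    mem_dihedral_five_cases I1_mul_self I3_mul_self I1_I3_braid hd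

theorem continuous_height : Continuous height :=
  continuous_normSq.comp <| (continuous_apply 1).comp <| continuous_id.matrix_mulVec
    continuous_const

end TriangleGroup

theorem even_subgroup_discrete
    (g1 g2 : GL (Fin 3) ℂ)
    (h1 : (g1 : Matrix (Fin 3) (Fin 3) ℂ) = I1 * I2)
    (h2 : (g2 : Matrix (Fin 3) (Fin 3) ℂ) = I2 * I3) :
    DiscreteTopology (Subgroup.closure ({g1, g2} : Set (GL (Fin 3) ℂ))) := by
  set G := Subgroup.closure ({g1, g2} : Set (GL (Fin 3) ℂ))
  let φ : G → Matrix (Fin 3) (Fin 3) ℂ := fun g => ((g : GL (Fin 3) ℂ) : Matrix _ _ ℂ)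
  have hφ : Continuous φ := Units.continuous_val.comp continuous_subtype_val
  have hφ_inj : Function.Injective φ := Units.val_injective.comp Subtype.val_injective
  refine discreteTopology_of_isOpen_singleton_one
    (isOpen_singleton_of_finite_mem_nhds (1 : G) (s := {g | height (φ g) < height I2}) ?_ ?_)
  · exact (isOpen_lt (continuous_height.comp hφ) continuous_const).mem_nhds
      (by simpa [φ] using height_one_lt)
  · refine (finite_stabilizer.preimage hφ_inj.injOn).subset fun g hg => ?_
    exact (mem_stabilizer_or_height_le (coe_mem_of_mem_closure h1 h2 g.2)).resolve_right hg.not_ge
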